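/- Suppose φ : ℝ → ℝ is absolutely continuous with |φ'(x)| ≤ a·e^{b|x|} a.e. for some a, b > 0. Define T_∞(Σ) = E_{(x,y)~N(0,Σ)}[φ(x)φ(y)] for 2×2 PSD matrices Σ. Then for every R ≥ 1 there exists β = β(φ,R) > 0 such that for all Σ, Σ' ∈ PSD₂(R), |T_∞(Σ) − T_∞(Σ')| ≤ β‖Σ − Σ'‖_∞. -/

import Mathlib

open MeasureTheory ProbabilityTheory Real NNReal

/-- `μ` is a centered Gaussian measure on `ι → ℝ` with covariance `S`. -/
def IsCenteredGaussianVec {ι : Type*} [Fintype ι] (μ : Measure (ι → ℝ))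
    (S : ι → ι → ℝ) : Prop :=
  IsProbabilityMeasure μ ∧ ∀ a : ι → ℝ,
    μ.map (fun x => ∑ i, a i * x i) =
      gaussianReal 0 (∑ i, ∑ j, a i * S i j * a j).toNNReal

/-- Membership in `PSD₂(R)`: symmetric, positive semi-definite, diagonal in `[1/R, R]`. -/
def InPSD2 (R : ℝ) (S : Fin 2 → Fin 2 → ℝ) : Prop :=
  (∀ i j, S i j = S j i) ∧ (∀ v : Fin 2 → ℝ, 0 ≤ ∑ i, ∑ j, v i * S i j * v j) ∧
    (∀ i, 1 / R ≤ S i i ∧ S i i ≤ R)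

abbrev EE := EuclideanSpace ℝ (Fin 5)

lemma aux_map_inner (u : EE) :
    (stdGaussian EE).map (fun x => inner ℝ u x) = gaussianReal 0 (‖u‖ ^ 2).toNNReal := by
  have h := IsGaussian.map_eq_gaussianReal (μ := stdGaussian EE) (innerSL ℝ u)
  rw [integral_strongDual_stdGaussian, variance_dual_stdGaussian, innerSL_apply_norm] at h
  exact h

lemma aux_gram (w : Fin 2 → EE) :
    IsCenteredGaussianVec ((stdGaussian EE).map (fun x i => inner ℝ (w i) x))
      (fun i j => inner ℝ (w i) (w j)) := by
  have hm : Measurable (fun (x : EE) (i : Fin 2) => inner ℝ (w i) x) := by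
    apply Continuous.measurable
    fun_prop
  refine ⟨Measure.isProbabilityMeasure_map hm.aemeasurable, fun a => ?_⟩
  rw [Measure.map_map (by fun_prop) hm]
  have h1 : ((fun x : Fin 2 → ℝ => ∑ i, a i * x i) ∘
      fun (x : EE) (i : Fin 2) => inner ℝ (w i) x) = fun x => inner ℝ (∑ i, a i • w i) x := by
    ext x
    simp [sum_inner, inner_add_left, real_inner_smul_left]
  rw [h1, aux_map_inner]
  congr 2
  rw [← real_inner_self_eq_norm_sq]
  simp only [Fin.sum_univ_two, inner_add_left, inner_add_right, real_inner_smul_left,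
    real_inner_smul_right]
  ring

lemma aux_uniq {S : Fin 2 → Fin 2 → ℝ} {μ ν : Measure (Fin 2 → ℝ)}
    (h1 : IsCenteredGaussianVec μ S) (h2 : IsCenteredGaussianVec ν S) : μ = ν := by
  have := h1.1
  have := h2.1
  refine Measure.ext_of_charFunDual ?_
  ext L
  rw [charFunDual_eq_charFun_map_one, charFunDual_eq_charFun_map_one]
  have hL : (L : (Fin 2 → ℝ) → ℝ) = fun x => ∑ i, (L (Pi.single i 1)) * x i := by
    ext x
    conv_lhs => rw [← Finset.univ_sum_single x]
    rw [map_sum]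
    refine Finset.sum_congr rfl fun i _ => ?_
    have : (Pi.single i (x i) : Fin 2 → ℝ) = x i • Pi.single i 1 := by
      rw [← Pi.single_smul]; simp
    rw [this, map_smul, smul_eq_mul, mul_comm]
  rw [hL, h1.2, h2.2]

noncomputable def GG (f h : ℝ → ℝ) (u v : EE) : ℝ :=
  ∫ x, f (inner ℝ u x) * h (inner ℝ v x) ∂(stdGaussian EE)

lemma aux_T {S : Fin 2 → Fin 2 → ℝ} {μ : Measure (Fin 2 → ℝ)}
    (h1 : IsCenteredGaussianVec μ S) (u v : EE) (h00 : S 0 0 = inner ℝ u u)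
    (h01 : S 0 1 = inner ℝ u v) (h10 : S 1 0 = inner ℝ u v) (h11 : S 1 1 = inner ℝ v v)
    (f h : ℝ → ℝ) (hf : Continuous f) (hh : Continuous h) :
    ∫ x, f (x 0) * h (x 1) ∂μ = GG f h u v := by
  have hS : S = fun i j => inner ℝ ((![u, v] : Fin 2 → EE) i) ((![u, v] : Fin 2 → EE) j) := by
    ext i j
    fin_cases i <;> fin_cases j <;> simp [h00, h01, h10, h11, real_inner_comm]
  rw [hS] at h1
  rw [aux_uniq h1 (aux_gram _), integral_map]
  · simp [GG]
  · apply Continuous.aemeasurable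
    fun_prop
  · apply Continuous.aestronglyMeasurable
    fun_prop

lemma aux_inv (u v u' v' : EE) (h00 : inner ℝ u u = inner ℝ u' u')
    (h01 : inner ℝ u v = inner ℝ u' v') (h11 : inner ℝ v v = inner ℝ v' v')
    (f h : ℝ → ℝ) (hf : Continuous f) (hh : Continuous h) :
    GG f h u v = GG f h u' v' := by
  have h1 := aux_gram ![u, v]
  rw [← aux_T h1 u v (by simp) (by simp) (by simp [real_inner_comm]) (by simp) f h hf hh]
  exact aux_T h1 u' v' (by simpa using h00) (by simpa using h01)
    (by simpa [real_inner_comm] using h01) (by simpa using h11) f h hf hh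

lemma aux_int (K : ℝ) : Integrable (fun x : EE => rexp (K * ‖x‖)) (stdGaussian EE) := by
  obtain ⟨C, hC, hi⟩ := IsGaussian.exists_integrable_exp_sq (stdGaussian EE)
  refine (hi.const_mul (rexp (K ^ 2 / (4 * C)))).mono'
    (by apply Continuous.aestronglyMeasurable; fun_prop) (ae_of_all _ fun x => ?_)
  rw [Real.norm_eq_abs, abs_of_pos (exp_pos _), ← Real.exp_add]
  apply Real.exp_le_exp.2
  have : K ^ 2 / (4 * C) + C * ‖x‖ ^ 2 - K * ‖x‖ = (K - 2 * C * ‖x‖) ^ 2 / (4 * C) := by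
    field_simp; ring
  have : 0 ≤ (K - 2 * C * ‖x‖) ^ 2 / (4 * C) := by positivity
  linarith

structure Good (K : ℝ) (f : ℝ → ℝ) : Prop where
  cont : Continuous f
  zero : |f 0| ≤ K
  lip : ∀ s t M : ℝ, |s| ≤ M → |t| ≤ M → |f s - f t| ≤ K * |s - t| * rexp (K * M)

lemma Good.nonneg {K f} (hf : Good K f) : 0 ≤ K := (abs_nonneg _).trans hf.zero

lemma Good.neg {K f} (hf : Good K f) : Good K (fun x => f (-x)) where
  cont := hf.cont.comp continuous_neg
  zero := by simpa using hf.zero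
  lip s t M hs ht := by
    have := hf.lip (-s) (-t) M (by simpa using hs) (by simpa using ht)
    rwa [show |-s - -t| = |s - t| by rw [← abs_neg]; ring_nf] at this

lemma Good.bd {K f} (hf : Good K f) (s M : ℝ) (hs : |s| ≤ M) :
    |f s| ≤ K * rexp ((K + 1) * M) := by
  have hM : 0 ≤ M := (abs_nonneg _).trans hs
  have hK := hf.nonneg
  have h1 := hf.lip s 0 M hs (by simpa using hM)
  have h2 : |f s| ≤ |f s - f 0| + |f 0| := by
    have := abs_add_le (f s - f 0) (f 0); simpa using this
  have h3 : 1 ≤ rexp (K * M) := Real.one_le_exp (by positivity)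
  have h4 : M + 1 ≤ rexp M := Real.add_one_le_exp M
  rw [sub_zero] at h1
  calc |f s| ≤ K * |s| * rexp (K * M) + K := h2.trans (add_le_add h1 hf.zero)
    _ ≤ K * M * rexp (K * M) + K * rexp (K * M) := by
      gcongr
      nlinarith
    _ = K * (rexp (K * M) * (M + 1)) := by ring
    _ ≤ K * (rexp (K * M) * rexp M) := by gcongr
    _ = K * rexp ((K + 1) * M) := by rw [← Real.exp_add]; ring_nf

lemma aux_in (u x : EE) (hu : ‖u‖ = 1) : |inner ℝ u x| ≤ ‖x‖ := by
  have := abs_real_inner_le_norm u x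
  rwa [hu, one_mul] at this

lemma aux_integrable {K f h} (hf : Good K f) (hh : Good K h) (u v : EE) (hu : ‖u‖ = 1)
    (hv : ‖v‖ = 1) :
    Integrable (fun x => f (inner ℝ u x) * h (inner ℝ v x)) (stdGaussian EE) := by
  have hf' := hf.cont
  have hh' := hh.cont
  refine ((aux_int (2 * K + 2)).const_mul (K * K)).mono'
    (by apply Continuous.aestronglyMeasurable; fun_prop) (ae_of_all _ fun x => ?_)
  rw [Real.norm_eq_abs, abs_mul]
  have h1 := hf.bd _ _ (aux_in u x hu)
  have h2 := hh.bd _ _ (aux_in v x hv)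
  have hK := hf.nonneg
  calc _ ≤ (K * rexp ((K + 1) * ‖x‖)) * (K * rexp ((K + 1) * ‖x‖)) := by gcongr
    _ = K * K * (rexp ((K + 1) * ‖x‖) * rexp ((K + 1) * ‖x‖)) := by ring
    _ = _ := by rw [← Real.exp_add]; ring_nf

noncomputable def JJ (K : ℝ) : ℝ := ∫ x, rexp ((2 * K + 2) * ‖x‖) ∂(stdGaussian EE)

lemma JJ_nonneg (K : ℝ) : 0 ≤ JJ K := integral_nonneg fun _ => (exp_pos _).le

lemma aux_le_exp (x : ℝ) : x ≤ rexp x := by linarith [Real.add_one_le_exp x]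

lemma aux_core {K f h} (hf : Good K f) (hh : Good K h) (u u2 v1 v2 : EE) (hu : ‖u‖ = 1)
    (hu2 : ‖u2‖ = 1) (hv1 : ‖v1‖ = 1) (hv2 : ‖v2‖ = 1)
    (h1 : inner ℝ u v1 = inner ℝ u2 v2) (h2 : inner ℝ u v2 = inner ℝ u2 v1) :
    2 * |GG f h u v1 - GG f h u v2| ≤ K ^ 2 * (‖u - u2‖ * ‖v1 - v2‖) * JJ K := by
  have hK := hf.nonneg
  have e1 : GG f h u v1 = GG f h u2 v2 :=
    aux_inv _ _ _ _ (by simp [hu, hu2]) h1 (by simp [hv1, hv2]) f h hf.cont hh.cont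
  have e2 : GG f h u v2 = GG f h u2 v1 :=
    aux_inv _ _ _ _ (by simp [hu, hu2]) h2 (by simp [hv1, hv2]) f h hf.cont hh.cont
  have i1 := aux_integrable hf hh u v1 hu hv1
  have i2 := aux_integrable hf hh u v2 hu hv2
  have i3 := aux_integrable hf hh u2 v1 hu2 hv1
  have i4 := aux_integrable hf hh u2 v2 hu2 hv2
  have e3 : 2 * (GG f h u v1 - GG f h u v2) =
      ∫ x, (f (inner ℝ u x) - f (inner ℝ u2 x)) * (h (inner ℝ v1 x) - h (inner ℝ v2 x))
        ∂(stdGaussian EE) := by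
    have : 2 * (GG f h u v1 - GG f h u v2) =
      (GG f h u v1 - GG f h u v2) - (GG f h u2 v1 - GG f h u2 v2) := by rw [← e1, ← e2]; ring
    rw [this]
    unfold GG
    rw [← integral_sub i1 i2, ← integral_sub i3 i4, ← integral_sub (by exact i1.sub i2) (by exact i3.sub i4)]
    congr 1
    ext x
    ring
  have e4 : 2 * |GG f h u v1 - GG f h u v2| = |2 * (GG f h u v1 - GG f h u v2)| := by
    rw [abs_mul]; simp
  rw [e4, e3, JJ, ← integral_const_mul]
  rw [← Real.norm_eq_abs]
  refine norm_integral_le_of_norm_le ((aux_int _).const_mul _) (ae_of_all _ fun x => ?_)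
  rw [Real.norm_eq_abs, abs_mul]
  have b1 := hf.lip _ _ _ (aux_in u x hu) (aux_in u2 x hu2)
  have b2 := hh.lip _ _ _ (aux_in v1 x hv1) (aux_in v2 x hv2)
  rw [← inner_sub_left] at b1 b2
  have c1 := abs_real_inner_le_norm (u - u2) x
  have c2 := abs_real_inner_le_norm (v1 - v2) x
  have d := aux_le_exp ‖x‖
  calc _ ≤ (K * |inner ℝ (u - u2) x| * rexp (K * ‖x‖)) *
        (K * |inner ℝ (v1 - v2) x| * rexp (K * ‖x‖)) := by gcongr
    _ ≤ (K * (‖u - u2‖ * rexp ‖x‖) * rexp (K * ‖x‖)) *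
        (K * (‖v1 - v2‖ * rexp ‖x‖) * rexp (K * ‖x‖)) := by
      gcongr
      · exact c1.trans (by gcongr)
      · exact c2.trans (by gcongr)
    _ = K ^ 2 * (‖u - u2‖ * ‖v1 - v2‖) *
        (rexp ‖x‖ * rexp (K * ‖x‖) * (rexp ‖x‖ * rexp (K * ‖x‖))) := by ring
    _ = _ := by
      rw [← Real.exp_add, ← Real.exp_add]; ring_nf

noncomputable def u0 : EE := !₂[1, 0, 0, 0, 0]
noncomputable def v0 (r : ℝ) : EE := !₂[r, √(1 - r ^ 2), 0, 0, 0]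

lemma in_five (a b : EE) : inner ℝ a b = b 0 * a 0 + b 1 * a 1 + b 2 * a 2 + b 3 * a 3 + b 4 * a 4 := by
  simp [PiLp.inner_apply, Fin.sum_univ_five]

lemma u0_in : inner ℝ u0 u0 = (1 : ℝ) := by
  rw [in_five]; simp [u0]

lemma v0_in (r : ℝ) (h : |r| ≤ 1) : inner ℝ (v0 r) (v0 r) = (1 : ℝ) := by
  have : 0 ≤ 1 - r ^ 2 := by nlinarith [sq_abs r, abs_nonneg r]
  rw [in_five]; simp [v0, Real.mul_self_sqrt this]; ring

lemma u0v0_in (r : ℝ) : inner ℝ u0 (v0 r) = r := by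
  rw [in_five]; simp [v0, u0]

lemma norm_one_of {u : EE} (h : inner ℝ u u = (1 : ℝ)) : ‖u‖ = 1 := by
  rw [real_inner_self_eq_norm_sq] at h
  nlinarith [norm_nonneg u]

noncomputable def FF (f h : ℝ → ℝ) (r : ℝ) : ℝ := GG f h u0 (v0 r)

lemma aux_rho_nonneg {K f h} (hf : Good K f) (hh : Good K h) (r r' : ℝ) (h0 : 0 ≤ r)
    (hr : r ≤ r') (h1 : r' ≤ 1) : |FF f h r' - FF f h r| ≤ K ^ 2 * JJ K * (r' - r) := by
  obtain ⟨p, hp⟩ : ∃ p, p = √r := ⟨_, rfl⟩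
  obtain ⟨d, hd⟩ : ∃ p, p = √(r' - r) := ⟨_, rfl⟩
  obtain ⟨q, hq⟩ : ∃ p, p = √(1 - r') := ⟨_, rfl⟩
  have hp2 : p * p = r := by rw [hp]; exact Real.mul_self_sqrt h0
  have hd2 : d * d = r' - r := by rw [hd]; exact Real.mul_self_sqrt (by linarith)
  have hq2 : q * q = 1 - r' := by rw [hq]; exact Real.mul_self_sqrt (by linarith)
  let u : EE := !₂[p, d, 0, q, 0]
  let u2 : EE := !₂[p, 0, d, q, 0]
  let v1 : EE := !₂[p, d, 0, 0, q]
  let v2 : EE := !₂[p, 0, d, 0, q]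
  have nu : inner ℝ u u = (1 : ℝ) := by rw [in_five]; simp [u]; linarith
  have nu2 : inner ℝ u2 u2 = (1 : ℝ) := by rw [in_five]; simp [u2]; linarith
  have nv1 : inner ℝ v1 v1 = (1 : ℝ) := by rw [in_five]; simp [v1]; linarith
  have nv2 : inner ℝ v2 v2 = (1 : ℝ) := by rw [in_five]; simp [v2]; linarith
  have a1 : inner ℝ u v1 = r' := by rw [in_five]; simp [u, v1]; linarith
  have a2 : inner ℝ u2 v2 = r' := by rw [in_five]; simp [u2, v2]; linarith
  have a3 : inner ℝ u v2 = r := by rw [in_five]; simp [u, v2]; linarith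
  have a4 : inner ℝ u2 v1 = r := by rw [in_five]; simp [u2, v1]; linarith
  have a5 : inner ℝ u u2 = 1 - (r' - r) := by rw [in_five]; simp [u, u2]; linarith
  have a6 : inner ℝ v1 v2 = 1 - (r' - r) := by rw [in_five]; simp [v1, v2]; linarith
  have n1 := norm_one_of nu
  have n2 := norm_one_of nu2
  have n3 := norm_one_of nv1
  have n4 := norm_one_of nv2
  have m1 : ‖u - u2‖ ^ 2 = 2 * (r' - r) := by
    rw [norm_sub_sq_real, n1, n2, a5]; ring
  have m2 : ‖v1 - v2‖ ^ 2 = 2 * (r' - r) := by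
    rw [norm_sub_sq_real, n3, n4, a6]; ring
  have m3 : ‖u - u2‖ * ‖v1 - v2‖ ≤ 2 * (r' - r) := by
    nlinarith [sq_nonneg (‖u - u2‖ - ‖v1 - v2‖)]
  have c := aux_core hf hh u u2 v1 v2 n1 n2 n3 n4 (a1.trans a2.symm) (a3.trans a4.symm)
  have e1 : FF f h r' = GG f h u v1 := aux_inv _ _ _ _ (u0_in.trans nu.symm)
    ((u0v0_in r').trans a1.symm) ((v0_in r' (abs_le.2 ⟨by linarith, h1⟩)).trans nv1.symm) f h
    hf.cont hh.cont
  have e2 : FF f h r = GG f h u v2 := aux_inv _ _ _ _ (u0_in.trans nu.symm)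
    ((u0v0_in r).trans a3.symm) ((v0_in r (abs_le.2 ⟨by linarith, by linarith⟩)).trans nv2.symm)
    f h hf.cont hh.cont
  rw [e1, e2]
  have : K ^ 2 * (‖u - u2‖ * ‖v1 - v2‖) * JJ K ≤ K ^ 2 * (2 * (r' - r)) * JJ K := by
    have := JJ_nonneg K
    gcongr
  linarith

lemma FF_neg {K f h} (hf : Good K f) (hh : Good K h) (r : ℝ) (hr : |r| ≤ 1) :
    FF f h (-r) = FF f (fun x => h (-x)) r := by
  have : FF f (fun x => h (-x)) r = GG f h u0 (-(v0 r)) := by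
    simp [FF, GG]
  rw [this]
  refine aux_inv _ _ _ _ rfl ?_ ?_ f h hf.cont hh.cont
  · rw [u0v0_in, inner_neg_right, u0v0_in]
  · rw [v0_in _ (by simpa using hr), inner_neg_neg, v0_in _ hr]

lemma aux_rho_le {K f h} (hf : Good K f) (hh : Good K h) (r r' : ℝ) (h0 : -1 ≤ r)
    (hr : r ≤ r') (h1 : r' ≤ 1) : |FF f h r' - FF f h r| ≤ K ^ 2 * JJ K * (r' - r) := by
  have key : ∀ s s' : ℝ, -1 ≤ s → s ≤ s' → s' ≤ 0 →
      |FF f h s' - FF f h s| ≤ K ^ 2 * JJ K * (s' - s) := by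
    intro s s' hs hss hs'
    have := aux_rho_nonneg hf hh.neg (-s') (-s) (by linarith) (by linarith) (by linarith)
    rw [← FF_neg hf hh _ (abs_le.2 ⟨by linarith, by linarith⟩),
      ← FF_neg hf hh _ (abs_le.2 ⟨by linarith, by linarith⟩), neg_neg, neg_neg, abs_sub_comm] at this
    linarith
  rcases le_total 0 r with h | h'
  · exact aux_rho_nonneg hf hh r r' h hr h1
  rcases le_total 0 r' with h2 | h2
  · have k1 := key r 0 h0 h' le_rfl
    have k2 := aux_rho_nonneg hf hh 0 r' le_rfl h2 h1
    have := abs_sub_le (FF f h r') (FF f h 0) (FF f h r)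
    linarith
  · exact key r r' h0 hr h2

lemma aux_rho {K f h} (hf : Good K f) (hh : Good K h) (r r' : ℝ) (h0 : |r| ≤ 1)
    (h1 : |r'| ≤ 1) : |FF f h r' - FF f h r| ≤ K ^ 2 * JJ K * |r' - r| := by
  rw [abs_le] at h0 h1
  rcases le_total r r' with h | h
  · rw [abs_of_nonneg (sub_nonneg.2 h)]
    exact aux_rho_le hf hh r r' h0.1 h h1.2
  · rw [abs_sub_comm r', abs_of_nonneg (sub_nonneg.2 h), abs_sub_comm]
    exact aux_rho_le hf hh r' r h1.1 h h0.2

lemma aux_sig1 {K f f' h} (hf : Good K f) (hf' : Good K f') (hh : Good K h) (ε : ℝ) (hε : 0 ≤ ε)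
    (hff : ∀ s, |f s - f' s| ≤ K * ε * |s| * rexp (K * |s|)) (u v : EE) (hu : ‖u‖ = 1)
    (hv : ‖v‖ = 1) : |GG f h u v - GG f' h u v| ≤ K ^ 2 * JJ K * ε := by
  have hK := hf.nonneg
  have e : GG f h u v - GG f' h u v =
      ∫ x, (f (inner ℝ u x) - f' (inner ℝ u x)) * h (inner ℝ v x) ∂(stdGaussian EE) := by
    unfold GG
    rw [← integral_sub (aux_integrable hf hh u v hu hv) (aux_integrable hf' hh u v hu hv)]
    congr 1
    ext x
    ring
  rw [e, show K ^ 2 * JJ K * ε = K ^ 2 * ε * JJ K by ring, JJ, ← integral_const_mul]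
  rw [← Real.norm_eq_abs]
  refine norm_integral_le_of_norm_le ((aux_int _).const_mul _) (ae_of_all _ fun x => ?_)
  rw [Real.norm_eq_abs, abs_mul]
  have c1 := aux_in u x hu
  have d := aux_le_exp ‖x‖
  calc _ ≤ (K * ε * |inner ℝ u x| * rexp (K * |inner ℝ u x|)) * (K * rexp ((K + 1) * ‖x‖)) := by
        gcongr
        · exact hff _
        · exact hh.bd _ _ (aux_in v x hv)
    _ ≤ (K * ε * rexp ‖x‖ * rexp (K * ‖x‖)) * (K * rexp ((K + 1) * ‖x‖)) := by
        gcongr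
        exact c1.trans d
    _ = K ^ 2 * ε * (rexp ‖x‖ * rexp (K * ‖x‖) * rexp ((K + 1) * ‖x‖)) := by ring
    _ = _ := by rw [← Real.exp_add, ← Real.exp_add]; ring_nf

lemma GG_comm (f h : ℝ → ℝ) (u v : EE) : GG f h u v = GG h f v u := by
  simp [GG, mul_comm]

lemma aux_phi (φ g : ℝ → ℝ) (a b : ℝ) (ha : 0 < a) (hb : 0 < b)
    (hg : Measurable g)
    (hac : ∀ x, φ x = φ 0 + ∫ t in (0 : ℝ)..x, g t)
    (hgbound : ∀ᵐ x ∂(volume : Measure ℝ), |g x| ≤ a * Real.exp (b * |x|)) (s t M : ℝ)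
    (hs : |s| ≤ M) (ht : |t| ≤ M) : |φ s - φ t| ≤ a * |s - t| * rexp (b * M) := by
  have hint : ∀ x y : ℝ, IntervalIntegrable g volume x y := by
    intro x y
    have : IntervalIntegrable (fun x => a * Real.exp (b * |x|)) volume x y := by
      apply Continuous.intervalIntegrable
      fun_prop
    refine this.mono_fun hg.aestronglyMeasurable (ae_restrict_of_ae ?_)
    filter_upwards [hgbound] with z hz
    rw [Real.norm_eq_abs]
    exact hz.trans (le_abs_self _)
  have e : φ s - φ t = ∫ x in t..s, g x := by
    rw [hac s, hac t, ← intervalIntegral.integral_interval_sub_left (hint 0 s) (hint 0 t)]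
    ring
  rw [e]
  have := intervalIntegral.norm_integral_le_of_norm_le_const_ae (a := t) (b := s) (f := g)
    (C := a * rexp (b * M)) ?_
  · rw [Real.norm_eq_abs] at this
    linarith
  · filter_upwards [hgbound] with z hz hzm
    rw [Real.norm_eq_abs]
    refine hz.trans ?_
    have : |z| ≤ M := by
      rw [abs_le] at *
      rcases Set.mem_uIoc.1 hzm with h | h <;> constructor <;> linarith [h.1, h.2]
    gcongr

lemma aux_cont (φ : ℝ → ℝ) (a b : ℝ)
    (h : ∀ s t M : ℝ, |s| ≤ M → |t| ≤ M → |φ s - φ t| ≤ a * |s - t| * rexp (b * M)) :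
    Continuous φ := by
  rw [continuous_iff_continuousAt]
  intro x
  rw [ContinuousAt, tendsto_iff_norm_sub_tendsto_zero]
  have h1 : Filter.Tendsto (fun y => a * |y - x| * rexp (b * (|y| + |x|))) (nhds x) (nhds 0) := by
    have : Continuous (fun y => a * |y - x| * rexp (b * (|y| + |x|))) := by fun_prop
    simpa using this.tendsto x
  refine squeeze_zero (fun _ => norm_nonneg _) (fun y => ?_) h1
  exact h y x _ (by linarith [abs_nonneg x]) (by linarith [abs_nonneg y])

lemma aux_sqrt (R s s' C : ℝ) (hR : 1 ≤ R) (h1 : 1 / R ≤ s) (h2 : 1 / R ≤ s') (h : |s - s'| ≤ C) :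
    |√s - √s'| ≤ R * C := by
  have hR0 : 0 < R := by linarith
  have hi : 0 < 1 / R := by positivity
  have hi1 : 1 / R ≤ 1 := by rw [div_le_one hR0]; exact hR
  have low : ∀ z, 1 / R ≤ z → 1 / R ≤ √z := fun z hz =>
    Real.le_sqrt_of_sq_le (by nlinarith)
  have l1 := low s h1
  have l2 := low s' h2
  have e : s - s' = (√s - √s') * (√s + √s') := by
    have := Real.mul_self_sqrt (show 0 ≤ s by linarith)
    have := Real.mul_self_sqrt (show 0 ≤ s' by linarith)
    linarith
  rw [e, abs_mul, abs_of_pos (show 0 < √s + √s' by linarith)] at h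
  have h3 : |√s - √s'| * (1 / R) ≤ C := by
    refine le_trans ?_ h
    gcongr
    linarith
  rw [mul_one_div, div_le_iff₀ hR0] at h3
  linarith

/-- If `φ` is absolutely continuous with a.e. exponentially bounded derivative `g`, then
`Σ ↦ T_∞(Σ) = E_{N(0,Σ)}[φ(x)φ(y)]` is Lipschitz on `PSD₂(R)` w.r.t. the entrywise
sup-norm. -/
theorem T_infty_lipschitz (φ g : ℝ → ℝ) (a b : ℝ) (ha : 0 < a) (hb : 0 < b)
    (hg : Measurable g)
    (hac : ∀ x, φ x = φ 0 + ∫ t in (0 : ℝ)..x, g t)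
    (hgbound : ∀ᵐ x ∂(volume : Measure ℝ), |g x| ≤ a * Real.exp (b * |x|))
    (R : ℝ) (hR : 1 ≤ R) :
    ∃ β > (0 : ℝ), ∀ (S S' : Fin 2 → Fin 2 → ℝ),
      InPSD2 R S → InPSD2 R S' →
      ∀ (μ μ' : Measure (Fin 2 → ℝ)),
        IsCenteredGaussianVec μ S → IsCenteredGaussianVec μ' S' →
        ∀ C : ℝ, (∀ i j, |S i j - S' i j| ≤ C) →
          |(∫ x, φ (x 0) * φ (x 1) ∂μ) - ∫ x, φ (x 0) * φ (x 1) ∂μ'| ≤ β * C := by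
  have hR0 : 0 < R := by linarith
  have lipφ := aux_phi φ g a b ha hb hg hac hgbound
  have contφ := aux_cont φ a b lipφ
  obtain ⟨K, hKdef⟩ : ∃ K, K = R * a + R * b + |φ 0| := ⟨_, rfl⟩
  have hRa : 0 < R * a := by positivity
  have hRb : 0 < R * b := by positivity
  have hφ0 := abs_nonneg (φ 0)
  have hK : 0 < K := by linarith
  have haK : a ≤ K := by nlinarith
  have good : ∀ σ, 0 ≤ σ → σ ≤ R → Good K (fun x => φ (σ * x)) := by
    intro σ h0 h1
    refine ⟨by fun_prop, by simp; linarith, fun s t M hs ht => ?_⟩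
    have hM : 0 ≤ M := (abs_nonneg _).trans hs
    have := lipφ (σ * s) (σ * t) (R * M) (by rw [abs_mul, abs_of_nonneg h0]; gcongr)
      (by rw [abs_mul, abs_of_nonneg h0]; gcongr)
    refine this.trans ?_
    rw [← mul_sub, abs_mul, abs_of_nonneg h0]
    have e1 : b * (R * M) ≤ K * M := by
      rw [← mul_assoc]; gcongr; linarith
    have e2 : a * (σ * |s - t|) ≤ K * |s - t| := by
      rw [← mul_assoc]; gcongr; nlinarith
    gcongr
  have diff : ∀ σ σ' : ℝ, 0 ≤ σ → σ ≤ R → 0 ≤ σ' → σ' ≤ R → ∀ s,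
      |φ (σ * s) - φ (σ' * s)| ≤ K * |σ - σ'| * |s| * rexp (K * |s|) := by
    intro σ σ' h0 h1 h0' h1' s
    have := lipφ (σ * s) (σ' * s) (R * |s|) (by rw [abs_mul, abs_of_nonneg h0]; gcongr)
      (by rw [abs_mul, abs_of_nonneg h0']; gcongr)
    refine this.trans ?_
    rw [← sub_mul, abs_mul, ← mul_assoc]
    have e1 : b * (R * |s|) ≤ K * |s| := by
      rw [← mul_assoc]; gcongr; linarith
    gcongr
  have hJ := JJ_nonneg K
  refine ⟨K ^ 2 * JJ K * (2 * R + (R + 2 * R ^ 3)) + 1, by positivity, ?_⟩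
  intro S S' hS hS' μ μ' hμ hμ' C hC
  have hC0 : 0 ≤ C := (abs_nonneg _).trans (hC 0 0)
  -- representation
  have rep : ∀ (S : Fin 2 → Fin 2 → ℝ) (μ : Measure (Fin 2 → ℝ)), InPSD2 R S →
      IsCenteredGaussianVec μ S → ∃ r, |r| ≤ 1 ∧ S 0 1 = √(S 0 0) * √(S 1 1) * r ∧
      ∫ x, φ (x 0) * φ (x 1) ∂μ =
        FF (fun x => φ (√(S 0 0) * x)) (fun x => φ (√(S 1 1) * x)) r := by
    intro S μ hS hμ
    obtain ⟨hsym, hpsd, hd⟩ := hS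
    have hi : 0 < 1 / R := by positivity
    have p0 : 0 < S 0 0 := hi.trans_le (hd 0).1
    have p1 : 0 < S 1 1 := hi.trans_le (hd 1).1
    have q0 := Real.sqrt_pos.2 p0
    have q1 := Real.sqrt_pos.2 p1
    have m0 := Real.mul_self_sqrt p0.le
    have m1 := Real.mul_self_sqrt p1.le
    have er : S 0 1 = √(S 0 0) * √(S 1 1) * (S 0 1 / (√(S 0 0) * √(S 1 1))) := by
      field_simp
    have hr : |S 0 1 / (√(S 0 0) * √(S 1 1))| ≤ 1 := by
      rw [abs_div, abs_of_pos (mul_pos q0 q1), div_le_one (mul_pos q0 q1)]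
      apply abs_le_of_sq_le_sq _ (mul_pos q0 q1).le
      have h := hpsd ![S 1 1, - S 0 1]
      simp [Fin.sum_univ_two, hsym 1 0] at h
      have h' : 0 ≤ S 1 1 * (S 0 0 * S 1 1 - S 0 1 ^ 2) := by linarith
      have h'' := nonneg_of_mul_nonneg_right h' p1
      rw [mul_pow, Real.sq_sqrt p0.le, Real.sq_sqrt p1.le]
      linarith
    refine ⟨_, hr, er, ?_⟩
    rw [aux_T hμ (√(S 0 0) • u0) (√(S 1 1) • v0 (S 0 1 / (√(S 0 0) * √(S 1 1)))) ?_ ?_ ?_ ?_ φ φ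
      contφ contφ]
    · simp [FF, GG, real_inner_smul_left]
    · rw [real_inner_smul_left, real_inner_smul_right, u0_in]; linarith
    · rw [real_inner_smul_left, real_inner_smul_right, u0v0_in, ← mul_assoc]; exact er
    · rw [real_inner_smul_left, real_inner_smul_right, u0v0_in, ← mul_assoc, hsym 1 0]; exact er
    · rw [real_inner_smul_left, real_inner_smul_right, v0_in _ hr]; linarith
  obtain ⟨r, hr, er, hT⟩ := rep S μ hS hμ
  obtain ⟨r', hr', er', hT'⟩ := rep S' μ' hS' hμ'
  rw [hT, hT']
  have up : ∀ z, z ≤ R → √z ≤ R := fun z hz => Real.sqrt_le_iff.2 ⟨hR0.le, by nlinarith⟩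
  have s0 := aux_sqrt R _ _ C hR (hS.2.2 0).1 (hS'.2.2 0).1 (hC 0 0)
  have s1 := aux_sqrt R _ _ C hR (hS.2.2 1).1 (hS'.2.2 1).1 (hC 1 1)
  have t0 := up _ (hS.2.2 0).2
  have t1 := up _ (hS.2.2 1).2
  have t0' := up _ (hS'.2.2 0).2
  have t1' := up _ (hS'.2.2 1).2
  have z0 := Real.sqrt_nonneg (S 0 0)
  have z1 := Real.sqrt_nonneg (S 1 1)
  have z0' := Real.sqrt_nonneg (S' 0 0)
  have z1' := Real.sqrt_nonneg (S' 1 1)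
  have hp : 1 / R ≤ √(S 0 0) * √(S 1 1) := by
    rw [← Real.sqrt_mul (by have := (hS.2.2 0).1; have : 0 < 1 / R := by positivity
                            linarith)]
    apply Real.le_sqrt_of_sq_le
    rw [sq]
    exact mul_le_mul (hS.2.2 0).1 (hS.2.2 1).1 (by positivity)
      (by have := (hS.2.2 0).1; have : 0 < 1 / R := by positivity
          linarith)
  have hc01 := hC 0 1
  rw [er, er'] at hc01
  obtain ⟨x, hx⟩ : ∃ x, x = √(S 0 0) := ⟨_, rfl⟩
  obtain ⟨y, hy⟩ : ∃ x, x = √(S 1 1) := ⟨_, rfl⟩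
  obtain ⟨x', hx'⟩ : ∃ x, x = √(S' 0 0) := ⟨_, rfl⟩
  obtain ⟨y', hy'⟩ : ∃ x, x = √(S' 1 1) := ⟨_, rfl⟩
  rw [← hx, ← hx'] at s0
  rw [← hy, ← hy'] at s1
  rw [← hx] at t0 z0
  rw [← hy] at t1 z1
  rw [← hx'] at t0' z0'
  rw [← hy'] at t1' z1'
  rw [← hx, ← hy] at hp
  rw [← hx, ← hy, ← hx', ← hy'] at hc01 ⊢
  have hpp : |x * y - x' * y'| ≤ 2 * R ^ 2 * C := by
    calc |x * y - x' * y'| = |(x - x') * y + x' * (y - y')| := by ring_nf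
      _ ≤ |x - x'| * y + x' * |y - y'| := by
        refine (abs_add_le _ _).trans ?_
        rw [abs_mul, abs_mul, abs_of_nonneg z1, abs_of_nonneg z0']
      _ ≤ (R * C) * R + R * (R * C) := by gcongr
      _ = _ := by ring
  have hrr : |r - r'| ≤ (R + 2 * R ^ 3) * C := by
    have h1 : |x * y * (r - r')| ≤ C + 2 * R ^ 2 * C := by
      calc |x * y * (r - r')| = |(x * y * r - x' * y' * r') - (x * y - x' * y') * r'| := by ring_nf
        _ ≤ |x * y * r - x' * y' * r'| + |(x * y - x' * y') * r'| := abs_sub _ _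
        _ ≤ C + 2 * R ^ 2 * C * 1 := by
          rw [abs_mul (x * y - x' * y')]
          gcongr
        _ = _ := by ring
    rw [abs_mul, abs_of_nonneg (mul_nonneg z0 z1)] at h1
    have h2 : 1 / R * |r - r'| ≤ C + 2 * R ^ 2 * C := le_trans (by gcongr) h1
    rw [one_div_mul_eq_div, div_le_iff₀ hR0] at h2
    linarith
  have g0 := good x z0 t0
  have g1 := good y z1 t1
  have g0' := good x' z0' t0'
  have g1' := good y' z1' t1'
  have f1 := aux_sig1 g0 g0' g1 |x - x'| (abs_nonneg _) (diff x x' z0 t0 z0' t0') u0 (v0 r)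
    (norm_one_of u0_in) (norm_one_of (v0_in r hr))
  have f2 := aux_sig1 g1 g1' g0' |y - y'| (abs_nonneg _) (diff y y' z1 t1 z1' t1') (v0 r) u0
    (norm_one_of (v0_in r hr)) (norm_one_of u0_in)
  rw [GG_comm _ _ (v0 r) u0, GG_comm _ _ (v0 r) u0] at f2
  have f3 := aux_rho g0' g1' r' r hr' hr
  have hKJ : 0 ≤ K ^ 2 * JJ K := by positivity
  have k1 := mul_le_mul_of_nonneg_left s0 hKJ
  have k2 := mul_le_mul_of_nonneg_left s1 hKJ
  have k3 := mul_le_mul_of_nonneg_left hrr hKJ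
  unfold FF at *
  have tri1 := abs_sub_le (GG (fun z => φ (x * z)) (fun z => φ (y * z)) u0 (v0 r))
    (GG (fun z => φ (x' * z)) (fun z => φ (y * z)) u0 (v0 r))
    (GG (fun z => φ (x' * z)) (fun z => φ (y' * z)) u0 (v0 r'))
  have tri2 := abs_sub_le (GG (fun z => φ (x' * z)) (fun z => φ (y * z)) u0 (v0 r))
    (GG (fun z => φ (x' * z)) (fun z => φ (y' * z)) u0 (v0 r))
    (GG (fun z => φ (x' * z)) (fun z => φ (y' * z)) u0 (v0 r'))
  linarith
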